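/- Let f be a non-constant real polynomial and g = f′. For any real numbers a < b, the number of distinct real roots of f in (a, b] equals q(S_{f,g}(a)) − q(S_{f,g}(b)), where S_{f,g} is the Sturm matrix and q the negative index of inertia. (No assumption that a, b avoid multiple roots of f is needed.) -/

import Mathlib

open Polynomial Matrix

/-- The negative index of inertia of a real symmetric matrix. -/
noncomputable def negInertia {n : ℕ} (M : Matrix (Fin n) (Fin n) ℝ) : ℕ :=
  if h : M.IsHermitian then (Finset.univ.filter fun i => h.eigenvalues i < 0).card
  else 0

/-- The Sturm matrix: the `m × m` symmetric tridiagonal matrix with diagonal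
entries `d 1 x, …, d m x` and off-diagonal entries `1`. -/
noncomputable def sturmMatrix (m : ℕ) (d : ℕ → Polynomial ℝ) (x : ℝ) :
    Matrix (Fin m) (Fin m) ℝ :=
  Matrix.of fun i j =>
    if (i : ℕ) = (j : ℕ) then (d ((i : ℕ) + 1)).eval x
    else if (i : ℕ) + 1 = (j : ℕ) ∨ (j : ℕ) + 1 = (i : ℕ) then 1 else 0

/-- The quadratic form of a symmetric matrix is diagonal in a suitable basis of eigenvectors. -/
theorem Matrix.IsHermitian.exists_basis_dotProduct_mulVec {n : ℕ}
    {M : Matrix (Fin n) (Fin n) ℝ} (hM : M.IsHermitian) :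
    ∃ e : Module.Basis (Fin n) ℝ (Fin n → ℝ),
      (∀ v, v ⬝ᵥ M *ᵥ v = ∑ i, hM.eigenvalues i * e.repr v i ^ 2) ∧
      ∀ i, M *ᵥ e i = hM.eigenvalues i • e i := by
  refine ⟨hM.eigenvectorBasis.toBasis.map (WithLp.linearEquiv 2 ℝ (Fin n → ℝ)), fun v => ?_,
    fun i => by simpa using hM.mulVec_eigenvectorBasis i⟩
  set u := hM.eigenvectorBasis
  set y := u.repr (WithLp.toLp 2 v)
  have hy : ∀ i, v ⬝ᵥ (u i).ofLp = y i := fun i => by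
    simp [y, OrthonormalBasis.repr_apply_apply, EuclideanSpace.inner_eq_star_dotProduct]
  have hv : v = ∑ i, y i • (u i).ofLp := by
    simpa using (congrArg WithLp.ofLp (u.sum_repr (WithLp.toLp 2 v))).symm
  have hMv : M *ᵥ v = ∑ i, y i • hM.eigenvalues i • (u i).ofLp := by
    conv_lhs => rw [hv]
    simp only [Matrix.mulVec_sum, Matrix.mulVec_smul]
    exact Finset.sum_congr rfl fun i _ => by rw [hM.mulVec_eigenvectorBasis]
  rw [hMv, dotProduct_sum]
  refine Finset.sum_congr rfl fun i _ => ?_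
  rw [dotProduct_smul, dotProduct_smul, hy]
  have : (u.toBasis.map (WithLp.linearEquiv 2 ℝ (Fin n → ℝ))).repr v i = y i := rfl
  rw [this, smul_eq_mul, smul_eq_mul]
  ring

/-- A symmetric matrix is negative definite on a subspace of dimension `negInertia M` and
positive semidefinite on a complementary one. -/
theorem Matrix.IsHermitian.exists_submodule_neg_nonneg {n : ℕ}
    {M : Matrix (Fin n) (Fin n) ℝ} (hM : M.IsHermitian) :
    ∃ N P : Submodule ℝ (Fin n → ℝ),
      (∀ v ∈ N, v ≠ 0 → v ⬝ᵥ M *ᵥ v < 0) ∧ (∀ v ∈ P, 0 ≤ v ⬝ᵥ M *ᵥ v) ∧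
      Module.finrank ℝ N = negInertia M ∧ negInertia M + Module.finrank ℝ P = n ∧
      ((∀ v, M *ᵥ v = 0 → v = 0) → ∀ v ∈ P, v ≠ 0 → 0 < v ⬝ᵥ M *ᵥ v) := by
  classical
  obtain ⟨e, he, heig⟩ := hM.exists_basis_dotProduct_mulVec
  have hrank : ∀ s : Finset (Fin n), Module.finrank ℝ (Submodule.span ℝ (e '' s)) = s.card := by
    intro s
    have := finrank_span_eq_card (R := ℝ) (b := fun i : s => e i)
      (e.linearIndependent.comp _ Subtype.val_injective)
    rw [Fintype.card_coe] at this
    rw [← this, Set.image_eq_range]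
    rfl
  have hmem : ∀ (s : Finset (Fin n)) v, v ∈ Submodule.span ℝ (e '' s) →
      ∀ i ∉ s, e.repr v i = 0 := by
    intro s v hv i hi
    by_contra h
    exact hi (e.mem_span_image.1 hv (Finsupp.mem_support_iff.2 h))
  have hex : ∀ v : Fin n → ℝ, v ≠ 0 → ∃ i, e.repr v i ≠ 0 := by
    intro v hv
    by_contra! h
    exact hv (e.repr.map_eq_zero_iff.1 (Finsupp.ext h))
  set s := Finset.univ.filter fun i => hM.eigenvalues i < 0
  have hq : negInertia M = s.card := by rw [negInertia, dif_pos hM]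
  have hs : ∀ i, i ∈ s ↔ hM.eigenvalues i < 0 := by simp [s]
  have hP : ∀ v ∈ Submodule.span ℝ (e '' (sᶜ : Finset (Fin n))), ∀ i,
      0 ≤ hM.eigenvalues i * e.repr v i ^ 2 := by
    intro v hv i
    by_cases hi : i ∈ s
    · rw [hmem _ v hv i (by simpa using hi)]
      simp
    · exact mul_nonneg (not_lt.1 ((hs i).not.1 hi)) (sq_nonneg _)
  refine ⟨Submodule.span ℝ (e '' s), Submodule.span ℝ (e '' (sᶜ : Finset (Fin n))),
    fun v hv hv0 => ?_, fun v hv => ?_, by rw [hrank, hq], ?_, fun hker v hv hv0 => ?_⟩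
  · rw [he]
    obtain ⟨i, hi⟩ := hex v hv0
    have his : i ∈ s := by
      by_contra h
      exact hi (hmem s v hv i h)
    refine Finset.sum_neg' (fun j _ => ?_) ⟨i, Finset.mem_univ _,
      mul_neg_of_neg_of_pos ((hs i).1 his) (by positivity)⟩
    by_cases hj : j ∈ s
    · exact mul_nonpos_of_nonpos_of_nonneg ((hs j).1 hj).le (sq_nonneg _)
    · rw [hmem s v hv j hj]
      simp
  · rw [he]
    exact Finset.sum_nonneg fun i _ => hP v hv i
  · rw [hrank, hq, Finset.card_add_card_compl, Fintype.card_fin]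
  · rw [he]
    obtain ⟨i, hi⟩ := hex v hv0
    refine Finset.sum_pos' (fun j _ => hP v hv j) ⟨i, Finset.mem_univ _,
      lt_of_le_of_ne (hP v hv i) (Ne.symm (mul_ne_zero (fun h => ?_) (pow_ne_zero 2 hi)))⟩
    exact e.ne_zero i (hker _ (by rw [heig, h, zero_smul]))

/-- Sylvester's law of inertia, in terms of subspaces. -/
theorem negInertia_eq_finrank {n : ℕ} {M : Matrix (Fin n) (Fin n) ℝ} (hM : M.IsHermitian)
    {N P : Submodule ℝ (Fin n → ℝ)} (hN : ∀ v ∈ N, v ≠ 0 → v ⬝ᵥ M *ᵥ v < 0)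
    (hP : ∀ v ∈ P, 0 ≤ v ⬝ᵥ M *ᵥ v) (hNP : n ≤ Module.finrank ℝ N + Module.finrank ℝ P) :
    negInertia M = Module.finrank ℝ N := by
  have key : ∀ N P : Submodule ℝ (Fin n → ℝ), (∀ v ∈ N, v ≠ 0 → v ⬝ᵥ M *ᵥ v < 0) →
      (∀ v ∈ P, 0 ≤ v ⬝ᵥ M *ᵥ v) → Module.finrank ℝ N + Module.finrank ℝ P ≤ n := by
    intro N P hN hP
    have hd : Disjoint N P := Submodule.disjoint_def.2 fun v hv hv' => by
      by_contra h
      exact (hN v hv h).not_ge (hP v hv')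
    simpa using Submodule.finrank_add_finrank_le_of_disjoint hd
  obtain ⟨N₀, P₀, hN₀, hP₀, h₁, h₂, -⟩ := hM.exists_submodule_neg_nonneg
  have := key N P₀ hN hP₀
  have := key N₀ P hN₀ hP
  omega

theorem eventually_forall_mem_dotProduct_mulVec_pos {n : ℕ} {M : ℝ → Matrix (Fin n) (Fin n) ℝ}
    (hM : Continuous M) {c : ℝ} {V : Submodule ℝ (Fin n → ℝ)}
    (hV : ∀ v ∈ V, v ≠ 0 → 0 < v ⬝ᵥ M c *ᵥ v) :
    ∀ᶠ x in nhds c, ∀ v ∈ V, v ≠ 0 → 0 < v ⬝ᵥ M x *ᵥ v := by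
  have hK : IsCompact (Metric.sphere (0 : Fin n → ℝ) 1 ∩ V) :=
    (isCompact_sphere _ _).inter_right V.closed_of_finiteDimensional
  have hcont : Continuous fun z : ℝ × (Fin n → ℝ) => z.2 ⬝ᵥ M z.1 *ᵥ z.2 := by fun_prop
  have := hK.eventually_forall_of_forall_eventually (x₀ := c)
    (P := fun x v => 0 < v ⬝ᵥ M x *ᵥ v) fun v hv =>
      hcont.continuousAt.eventually (lt_mem_nhds (hV v hv.2 (by
        rintro rfl
        simpa using hv.1)))
  filter_upwards [this] with x hx v hv hv0
  have hn : 0 < ‖v‖ := norm_pos_iff.2 hv0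
  have h := hx (‖v‖⁻¹ • v) ⟨by simp [norm_smul, hn.ne'], V.smul_mem _ hv⟩
  rw [Matrix.mulVec_smul, dotProduct_smul, smul_dotProduct, smul_eq_mul, smul_eq_mul,
    mul_pos_iff_of_pos_left (by positivity), mul_pos_iff_of_pos_left (by positivity)] at h
  exact h

theorem eventually_forall_mem_dotProduct_mulVec_neg {n : ℕ} {M : ℝ → Matrix (Fin n) (Fin n) ℝ}
    (hM : Continuous M) {c : ℝ} {V : Submodule ℝ (Fin n → ℝ)}
    (hV : ∀ v ∈ V, v ≠ 0 → v ⬝ᵥ M c *ᵥ v < 0) :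
    ∀ᶠ x in nhds c, ∀ v ∈ V, v ≠ 0 → v ⬝ᵥ M x *ᵥ v < 0 := by
  simpa [Matrix.neg_mulVec] using
    eventually_forall_mem_dotProduct_mulVec_pos (M := fun x => -M x) hM.neg (c := c) (V := V)
      (by simpa [Matrix.neg_mulVec] using hV)

/-- The negative index of inertia is locally constant at nonsingular matrices. -/
theorem eventually_negInertia_eq {n : ℕ} {M : ℝ → Matrix (Fin n) (Fin n) ℝ}
    (hM : Continuous M) (hH : ∀ x, (M x).IsHermitian) {c : ℝ}
    (hker : ∀ v, M c *ᵥ v = 0 → v = 0) :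
    ∀ᶠ x in nhds c, negInertia (M x) = negInertia (M c) := by
  obtain ⟨N, P, hN, -, h₁, h₂, hP⟩ := (hH c).exists_submodule_neg_nonneg
  filter_upwards [eventually_forall_mem_dotProduct_mulVec_neg hM hN,
    eventually_forall_mem_dotProduct_mulVec_pos hM (hP hker)] with x hxN hxP
  rw [← h₁]
  refine negInertia_eq_finrank (N := N) (P := P) (hH x) hxN (fun v hv => ?_) (by omega)
  rcases eq_or_ne v 0 with rfl | h
  · simp
  · exact (hxP v hv h).le

theorem sturmMatrix_isHermitian (m : ℕ) (d : ℕ → Polynomial ℝ) (x : ℝ) :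
    (sturmMatrix m d x).IsHermitian := by
  ext i j
  simp only [sturmMatrix, conjTranspose_apply, of_apply, star_trivial]
  by_cases h : (i : ℕ) = j
  · simp [h]
  · simp [h, Ne.symm h, or_comm]

theorem continuous_sturmMatrix (m : ℕ) (d : ℕ → Polynomial ℝ) : Continuous (sturmMatrix m d) := by
  refine continuous_matrix fun i j => ?_
  simp only [sturmMatrix, of_apply]
  split_ifs
  · exact (d (i + 1)).continuous
  · exact continuous_const
  · exact continuous_const

theorem sturmMatrix_mulVec (m : ℕ) (d : ℕ → Polynomial ℝ) (x : ℝ) (u : ℕ → ℝ) (hu : u m = 0)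
    (i : Fin m) :
    (sturmMatrix m d x *ᵥ fun j => u j) i =
      (d (i + 1)).eval x * u i + u (i + 1) + if (i : ℕ) = 0 then 0 else u (i - 1) := by
  have hsum : (sturmMatrix m d x *ᵥ fun j => u j) i =
      ∑ j ∈ Finset.range m, (((if j = (i : ℕ) then (d (i + 1)).eval x * u j else 0) +
        if j = (i : ℕ) + 1 then u j else 0) +
        if (i : ℕ) ≠ 0 ∧ j = (i : ℕ) - 1 then u j else 0) := by
    rw [Finset.sum_range, mulVec, dotProduct]
    refine Finset.sum_congr rfl fun j _ => ?_
    simp only [sturmMatrix, of_apply]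
    grind
  have hi := i.isLt
  rw [hsum, Finset.sum_add_distrib, Finset.sum_add_distrib, Finset.sum_ite_eq',
    Finset.sum_ite_eq', if_pos (Finset.mem_range.2 hi)]
  congr 1
  · congr 1
    split_ifs with h
    · rfl
    · rw [Finset.mem_range] at h
      rw [show (i : ℕ) + 1 = m by omega, hu]
  · by_cases h : (i : ℕ) = 0
    · simp [h]
    · simp only [ne_eq, h, not_false_eq_true, true_and, if_false, Finset.sum_ite_eq']
      rw [if_pos (Finset.mem_range.2 (by omega))]

theorem cons_zero_dotProduct_sturmMatrix_mulVec (k : ℕ) (d : ℕ → Polynomial ℝ) (x : ℝ)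
    (v : Fin k → ℝ) :
    (Fin.cons 0 v : Fin (k + 1) → ℝ) ⬝ᵥ sturmMatrix (k + 1) d x *ᵥ (Fin.cons 0 v) =
      v ⬝ᵥ sturmMatrix k (fun i => d (i + 1)) x *ᵥ v := by
  simp [dotProduct, mulVec, Fin.sum_univ_succ, sturmMatrix]

/-- `G` is a polynomial Sturm chain with quotients `d`, ending in `1, 0`. -/
structure IsSturmChain (m : ℕ) (d G : ℕ → Polynomial ℝ) : Prop where
  rec_eq : ∀ i, i < m → G i = d (i + 1) * G (i + 1) - G (i + 2)
  last : G m = 1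
  last_succ : G (m + 1) = 0

namespace IsSturmChain

variable {m : ℕ} {d G : ℕ → Polynomial ℝ}

theorem tail {k : ℕ} (h : IsSturmChain (k + 1) d G) :
    IsSturmChain k (fun i => d (i + 1)) (fun i => G (i + 1)) :=
  ⟨fun i hi => h.rec_eq (i + 1) (by omega), h.last, h.last_succ⟩

/-- The vector `(G 1, -G 2, G 3, …)`, which the Sturm matrix maps to a multiple of the
first unit vector. -/
noncomputable def altVec (m : ℕ) (G : ℕ → Polynomial ℝ) (x : ℝ) : Fin m → ℝ :=
  fun i => (-1) ^ (i : ℕ) * (G (i + 1)).eval x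

theorem sturmMatrix_mulVec_altVec (h : IsSturmChain m d G) (x : ℝ) (i : Fin m) :
    (sturmMatrix m d x *ᵥ altVec m G x) i = if (i : ℕ) = 0 then (G 0).eval x else 0 := by
  refine (sturmMatrix_mulVec m d x (fun i => (-1) ^ i * (G (i + 1)).eval x)
    (by simp [h.last_succ]) i).trans ?_
  obtain ⟨i, hi⟩ := i
  have := congrArg (eval x) (h.rec_eq i hi)
  rw [eval_sub, eval_mul] at this
  cases i with
  | zero => simp_all [sub_eq_add_neg]
  | succ i =>
    simp only [Nat.add_eq_zero_iff, one_ne_zero, and_false, if_false, Nat.add_sub_cancel, this]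
    ring

theorem dotProduct_sturmMatrix_mulVec_altVec {k : ℕ} (h : IsSturmChain (k + 1) d G) (x : ℝ)
    (u : Fin (k + 1) → ℝ) :
    u ⬝ᵥ sturmMatrix (k + 1) d x *ᵥ altVec (k + 1) G x = u 0 * (G 0).eval x := by
  simp [dotProduct, h.sturmMatrix_mulVec_altVec]

theorem altVec_dotProduct_sturmMatrix_mulVec {k : ℕ} (h : IsSturmChain (k + 1) d G) (x : ℝ)
    (u : Fin (k + 1) → ℝ) :
    altVec (k + 1) G x ⬝ᵥ sturmMatrix (k + 1) d x *ᵥ u = u 0 * (G 0).eval x := by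
  have hs : (sturmMatrix (k + 1) d x)ᵀ = sturmMatrix (k + 1) d x := by
    simpa [IsHermitian, conjTranspose_eq_transpose_of_trivial] using
      sturmMatrix_isHermitian (k + 1) d x
  rw [dotProduct_mulVec, ← mulVec_transpose, hs, dotProduct_comm,
    h.dotProduct_sturmMatrix_mulVec_altVec]

/-- The Sturm matrix is nonsingular wherever `G 0` does not vanish. -/
theorem eq_zero_of_sturmMatrix_mulVec_eq_zero (h : IsSturmChain m d G) {x : ℝ}
    (hx : (G 0).eval x ≠ 0) (v : Fin m → ℝ) (hv : sturmMatrix m d x *ᵥ v = 0) : v = 0 := by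
  cases m with
  | zero => exact Subsingleton.elim _ _
  | succ k =>
    have h0 : v 0 = 0 := by
      have := h.altVec_dotProduct_sturmMatrix_mulVec x v
      rw [hv, dotProduct_zero] at this
      exact (mul_eq_zero.1 this.symm).resolve_right hx
    set u : ℕ → ℝ := fun i => if hi : i < k + 1 then v ⟨i, hi⟩ else 0
    have hu : v = fun i : Fin (k + 1) => u i := by
      ext i
      simp only [u, dif_pos i.isLt, Fin.eta]
    have hrec : ∀ i < k + 1, (d (i + 1)).eval x * u i + u (i + 1) +
        (if i = 0 then 0 else u (i - 1)) = 0 := by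
      intro i hi
      rw [← sturmMatrix_mulVec (k + 1) d x u (by simp [u]) ⟨i, hi⟩, ← hu, hv]
      rfl
    have hz : ∀ i ≤ k, u i = 0 ∧ u (i + 1) = 0 := by
      intro i hi
      induction i with
      | zero =>
        have hu0 : u 0 = 0 := h0
        have := hrec 0 (by omega)
        simp_all
      | succ i ih =>
        obtain ⟨h1, h2⟩ := ih (by omega)
        have := hrec (i + 1) (by omega)
        simp_all
    ext i
    rw [hu]
    exact (hz i (Nat.lt_succ_iff.1 i.isLt)).1

theorem eval_one_ne_zero (h : IsSturmChain m d G) {x : ℝ} (hx : (G 0).eval x = 0) :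
    (G 1).eval x ≠ 0 := by
  intro h1
  have hz : ∀ i ≤ m, (G i).eval x = 0 ∧ (G (i + 1)).eval x = 0 := by
    intro i hi
    induction i with
    | zero => exact ⟨hx, h1⟩
    | succ i ih =>
      obtain ⟨h1, h2⟩ := ih (by omega)
      have := congrArg (eval x) (h.rec_eq i (by omega))
      simp_all
  simpa [h.last] using (hz m le_rfl).1

theorem negInertia_eventually_eq (h : IsSturmChain m d G) {c : ℝ} (hc : (G 0).eval c ≠ 0) :
    ∀ᶠ x in nhds c, negInertia (sturmMatrix m d x) = negInertia (sturmMatrix m d c) :=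
  eventually_negInertia_eq (continuous_sturmMatrix m d) (sturmMatrix_isHermitian m d)
    (h.eq_zero_of_sturmMatrix_mulVec_eq_zero hc)

/-- Passing from the trailing principal submatrix to the whole Sturm matrix adds a negative
eigenvalue exactly when `G 0` and `G 1` have opposite signs. -/
theorem negInertia_succ {k : ℕ} (h : IsSturmChain (k + 1) d G) {x : ℝ} (hx : (G 1).eval x ≠ 0) :
    negInertia (sturmMatrix (k + 1) d x) =
      negInertia (sturmMatrix k (fun i => d (i + 1)) x) +
        if (G 0).eval x * (G 1).eval x < 0 then 1 else 0 := by
  obtain ⟨N, P, hN, hP, h₁, h₂, -⟩ :=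
    (sturmMatrix_isHermitian k (fun i => d (i + 1)) x).exists_submodule_neg_nonneg
  set w := altVec (k + 1) G x
  have hw0 : w 0 = (G 1).eval x := by simp [w, altVec]
  let J : (Fin k → ℝ) →ₗ[ℝ] (Fin (k + 1) → ℝ) :=
    { toFun := fun v => Fin.cons 0 v
      map_add' := fun u v => by ext i; cases i using Fin.cases <;> simp
      map_smul' := fun r v => by ext i; cases i using Fin.cases <;> simp }
  have hJ : Function.Injective J := fun u v huv => Fin.cons_right_injective (α := fun _ => ℝ) 0 huv
  have hJ0 : ∀ v, J v 0 = 0 := fun v => rfl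
  have hrank : ∀ V : Submodule ℝ (Fin k → ℝ),
      Module.finrank ℝ (V.map J) = Module.finrank ℝ V :=
    fun V => (Submodule.equivMapOfInjective J hJ V).finrank_eq.symm
  have hrank_sup : ∀ V : Submodule ℝ (Fin k → ℝ),
      Module.finrank ℝ (V.map J ⊔ Submodule.span ℝ {w} : Submodule ℝ (Fin (k + 1) → ℝ)) =
        Module.finrank ℝ V + 1 := by
    intro V
    rw [Submodule.finrank_sup_span_singleton, hrank]
    rintro ⟨v, -, hv⟩
    exact hx (by rw [← hw0, ← hv, hJ0])
  have hform : ∀ v (t : ℝ), (J v + t • w) ⬝ᵥ sturmMatrix (k + 1) d x *ᵥ (J v + t • w) =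
      v ⬝ᵥ sturmMatrix k (fun i => d (i + 1)) x *ᵥ v +
        t ^ 2 * ((G 0).eval x * (G 1).eval x) := by
    intro v t
    have hJJ : J v ⬝ᵥ sturmMatrix (k + 1) d x *ᵥ J v = _ :=
      cons_zero_dotProduct_sturmMatrix_mulVec k d x v
    simp only [mulVec_add, mulVec_smul, dotProduct_add, add_dotProduct, dotProduct_smul,
      smul_dotProduct, smul_eq_mul, w, h.dotProduct_sturmMatrix_mulVec_altVec,
      h.altVec_dotProduct_sturmMatrix_mulVec, hJJ, hJ0]
    rw [Pi.add_apply, Pi.smul_apply, hJ0, show altVec (k + 1) G x 0 = _ from hw0, smul_eq_mul]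
    ring
  have hformJ : ∀ v, J v ⬝ᵥ sturmMatrix (k + 1) d x *ᵥ J v =
      v ⬝ᵥ sturmMatrix k (fun i => d (i + 1)) x *ᵥ v := by
    intro v
    simpa using hform v 0
  split_ifs with hneg
  · rw [← h₁, ← hrank_sup]
    refine negInertia_eq_finrank (P := P.map J) (sturmMatrix_isHermitian _ d x) ?_ ?_
      (by rw [hrank_sup, hrank]; omega)
    · rintro _ hu hu0
      obtain ⟨_, ⟨v, hv, rfl⟩, _, hw, rfl⟩ := Submodule.mem_sup.1 hu
      obtain ⟨t, rfl⟩ := Submodule.mem_span_singleton.1 hw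
      rw [hform]
      rcases eq_or_ne v 0 with rfl | hv0
      · have ht : t ≠ 0 := by
          rintro rfl
          simp at hu0
        simpa using mul_neg_of_pos_of_neg (by positivity : 0 < t ^ 2) hneg
      · exact add_neg_of_neg_of_nonpos (hN v hv hv0)
          (mul_nonpos_of_nonneg_of_nonpos (sq_nonneg t) hneg.le)
    · rintro _ ⟨v, hv, rfl⟩
      rw [hformJ]
      exact hP v hv
  · rw [add_zero, ← h₁, ← hrank]
    refine negInertia_eq_finrank (P := P.map J ⊔ Submodule.span ℝ {w})
      (sturmMatrix_isHermitian _ d x) ?_ ?_ (by rw [hrank_sup, hrank]; omega)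
    · rintro _ ⟨v, hv, rfl⟩ hv0
      rw [hformJ]
      exact hN v hv fun h => hv0 (by rw [h, map_zero])
    · intro _ hu
      obtain ⟨_, ⟨v, hv, rfl⟩, _, hw, rfl⟩ := Submodule.mem_sup.1 hu
      obtain ⟨t, rfl⟩ := Submodule.mem_span_singleton.1 hw
      rw [hform]
      exact add_nonneg (hP v hv) (mul_nonneg (sq_nonneg t) (not_lt.1 hneg))

end IsSturmChain

/-- If `p / q` is `f` divided by its derivative then near a root `c` of `f` the sign of `p * q` at `x` is that
of `x - c`. -/
theorem eventually_eval_mul_eval_neg_iff {f p q : Polynomial ℝ} (hf : f ≠ 0)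
    (hpq : p * derivative f = q * f) {c : ℝ} (hc : f.eval c = 0) (hq : p.eval c = 0 → q.eval c ≠ 0) :
    p.eval c = 0 ∧ ∀ᶠ x in nhds c, (p.eval x * q.eval x < 0 ↔ x < c) := by
  obtain ⟨h, hfh, hdvd⟩ := exists_eq_pow_rootMultiplicity_mul_and_not_dvd f hf c
  obtain ⟨k, hk⟩ : ∃ k, rootMultiplicity c f = k + 1 :=
    Nat.exists_eq_succ_of_ne_zero ((rootMultiplicity_pos hf).2 hc).ne'
  rw [hk] at hfh
  have hhc : h.eval c ≠ 0 := fun H => hdvd (dvd_iff_isRoot.2 H)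
  set r : Polynomial ℝ := C ((k : ℝ) + 1) * h + (X - C c) * derivative h
  have hr : p * r = (X - C c) * (q * h) := by
    refine mul_left_cancel₀ (pow_ne_zero k (X_sub_C_ne_zero c)) ?_
    have hd : derivative f = (X - C c) ^ k * r := by
      rw [hfh, derivative_mul, derivative_X_sub_C_pow]
      simp only [r, Nat.cast_add, Nat.cast_one, Nat.add_sub_cancel, map_add, map_one,
        Polynomial.C_eq_natCast]
      ring
    calc (X - C c) ^ k * (p * r) = p * derivative f := by rw [hd]; ring
      _ = (X - C c) ^ k * ((X - C c) * (q * h)) := by rw [hpq, hfh]; ring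
  have hev : ∀ x, p.eval x * r.eval x = (x - c) * (q.eval x * h.eval x) := by
    intro x
    simpa using congrArg (eval x) hr
  have hrc : r.eval c = (k + 1) * h.eval c := by simp [r]
  have hpos : 0 < r.eval c * h.eval c := by
    rw [hrc, mul_assoc, ← sq]
    positivity
  have hpc : p.eval c = 0 := by
    have := hev c
    rw [sub_self, zero_mul, hrc] at this
    exact (mul_eq_zero.1 this).resolve_right (mul_ne_zero (by positivity) hhc)
  refine ⟨hpc, ?_⟩
  filter_upwards [(r.continuous.mul h.continuous).continuousAt.eventually (lt_mem_nhds hpos),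
    q.continuous.continuousAt.eventually_ne (hq hpc)] with x hx hqx
  have hhx : h.eval x ≠ 0 := right_ne_zero_of_mul hx.ne'
  have heq : (p.eval x * q.eval x) * (r.eval x * h.eval x) =
      (x - c) * (q.eval x * h.eval x) ^ 2 := by
    linear_combination (q.eval x * h.eval x) * hev x
  have h2 : 0 < (q.eval x * h.eval x) ^ 2 := by positivity
  rw [← sub_neg (a := x)]
  constructor <;> intro hlt
  · exact neg_of_mul_neg_left (heq ▸ mul_neg_of_neg_of_pos hlt hx) h2.le
  · exact neg_of_mul_neg_left (heq.symm ▸ mul_neg_of_neg_of_pos hlt h2) hx.le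

theorem eventually_card_filter_le_eq {s : Finset ℝ} (c : ℝ) :
    ∀ᶠ x in nhds c, (s.filter (· ≤ x)).card + (if c ∈ s ∧ x < c then 1 else 0) =
      (s.filter (· ≤ c)).card := by
  have h : ∀ᶠ x in nhds c, ∀ r ∈ s, r ≠ c → (r ≤ x ↔ r ≤ c) := by
    refine (Filter.eventually_all_finset s).2 fun r _ => ?_
    rcases lt_trichotomy r c with hr | rfl | hr
    · filter_upwards [lt_mem_nhds hr] with x hx _
      exact ⟨fun _ => hr.le, fun _ => hx.le⟩
    · simp
    · filter_upwards [gt_mem_nhds hr] with x hx _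
      exact ⟨fun h => absurd h hx.not_ge, fun h => absurd h hr.not_ge⟩
  filter_upwards [h] with x hx
  split_ifs with hc
  · have : s.filter (· ≤ c) = insert c (s.filter (· ≤ x)) := by
      ext r
      by_cases hr : r = c
      · simp [hr, hc.1]
      · simp only [Finset.mem_filter, Finset.mem_insert, hr, false_or]
        exact and_congr_right fun hrs => (hx r hrs hr).symm
    rw [this, Finset.card_insert_of_notMem (by simp [hc.2])]
  · rw [add_zero]
    congr 1
    refine Finset.filter_congr fun r hrs => ?_
    by_cases hr : r = c
    · subst hr
      simpa [hrs] using hc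
    · exact hx r hrs hr

theorem exists_isSturmChain_mul_eq {m : ℕ} (hm : 1 ≤ m) {F d : ℕ → Polynomial ℝ}
    (hrec : ∀ i, 1 ≤ i → i < m → F (i - 1) = d i * F i - F (i + 1))
    (hlast : F (m - 1) = d m * F m) (hFm : F m ≠ 0) :
    ∃ G, IsSturmChain m d G ∧ ∀ i ≤ m, F i = F m * G i := by
  set E : ℕ → Polynomial ℝ := fun i => if i ≤ m then F i else 0
  have hE : ∀ i < m, E i = d (i + 1) * E (i + 1) - E (i + 2) := by
    intro i hi
    rcases Nat.lt_or_ge (i + 1) m with h | h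
    · simpa [E, hi.le, h.le, show i + 2 ≤ m by omega] using hrec (i + 1) (by omega) h
    · obtain rfl : m = i + 1 := by omega
      simpa [E] using hlast
  have hdvd : ∀ j, j ≤ m → F m ∣ E j ∧ F m ∣ E (j + 1) := by
    intro j hj
    induction hj using Nat.decreasingInduction with
    | self => simp [E]
    | of_succ j hj ih =>
      refine ⟨?_, ih.1⟩
      rw [hE j hj]
      exact dvd_sub (ih.1.mul_left _) ih.2
  have hdvd' : ∀ j, F m ∣ E j := fun j => by
    rcases Nat.lt_or_ge m j with h | h
    · simp [E, h.not_ge]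
    · exact (hdvd j h).1
  choose G hG using hdvd'
  refine ⟨G, ⟨fun i hi => mul_left_cancel₀ hFm ?_, mul_left_cancel₀ hFm ?_,
    mul_left_cancel₀ hFm ?_⟩, fun i hi => ?_⟩
  · rw [mul_sub, mul_left_comm, ← hG, ← hG, ← hG, hE i hi]
  · rw [← hG]
    simp [E]
  · rw [← hG]
    simp [E]
  · rw [← hG]
    simp [E, hi]

theorem stmt17 (f : Polynomial ℝ) (hf : 0 < f.natDegree)
    (g : Polynomial ℝ) (hg : g = derivative f)
    (m : ℕ) (hm : 1 ≤ m)
    (F d : ℕ → Polynomial ℝ)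
    (hF0 : F 0 = f) (hF1 : F 1 = g)
    (hrec : ∀ i, 1 ≤ i → i < m → F (i - 1) = d i * F i - F (i + 1))
    (hdeg : ∀ i, 1 ≤ i → i < m → (F (i + 1)).degree < (F i).degree)
    (hlast : F (m - 1) = d m * F m)
    (hFm : F m ≠ 0)
    (a b : ℝ) (hab : a < b) :
    ((Set.ncard {x ∈ Set.Ioc a b | f.eval x = 0} : ℤ))
      = (negInertia (sturmMatrix m d a) : ℤ) - (negInertia (sturmMatrix m d b) : ℤ) := by
  subst hg
  have hf0 : f ≠ 0 := ne_zero_of_natDegree_gt hf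
  obtain ⟨G, hG, hFG⟩ := exists_isSturmChain_mul_eq hm hrec hlast hFm
  obtain ⟨k, rfl⟩ : ∃ k, m = k + 1 := ⟨m - 1, by omega⟩
  have h0 : f = F (k + 1) * G 0 := hF0 ▸ hFG 0 (by omega)
  have h1 : derivative f = F (k + 1) * G 1 := hF1 ▸ hFG 1 hm
  have hpq : G 0 * derivative f = G 1 * f := by
    linear_combination G 0 * h1 - G 1 * h0
  set R := f.roots.toFinset
  have hR : ∀ x, x ∈ R ↔ f.eval x = 0 := fun x => by simp [R, hf0]
  have hlc : IsLocallyConstant fun x =>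
      negInertia (sturmMatrix (k + 1) d x) + (R.filter (· ≤ x)).card := by
    refine (IsLocallyConstant.iff_eventually_eq _).2 fun c => ?_
    suffices ∀ᶠ x in nhds c, negInertia (sturmMatrix (k + 1) d x) =
        negInertia (sturmMatrix (k + 1) d c) + if c ∈ R ∧ x < c then 1 else 0 by
      filter_upwards [this, eventually_card_filter_le_eq (s := R) c] with x hx hx'
      omega
    by_cases hc : f.eval c = 0
    · obtain ⟨hG0, hsign⟩ := eventually_eval_mul_eval_neg_iff hf0 hpq hc hG.eval_one_ne_zero
      have hG1 := hG.eval_one_ne_zero hG0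
      have hq := hG.tail.negInertia_eventually_eq hG1
      filter_upwards [hsign, hq, (G 1).continuous.continuousAt.eventually_ne hG1]
        with x hx hqx hG1x
      rw [hG.negInertia_succ hG1x, hG.negInertia_succ hG1, hqx]
      simp [hx, hG0, (hR c).2 hc]
    · have hG0 : (G 0).eval c ≠ 0 := by
        intro h
        rw [h0, eval_mul, h, mul_zero] at hc
        exact hc rfl
      simpa [(hR c).not.2 hc] using hG.negInertia_eventually_eq hG0
  have hab' := hlc.apply_eq_of_preconnectedSpace a b
  have hset : {x ∈ Set.Ioc a b | f.eval x = 0} =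
      ((R.filter (· ≤ b) \ R.filter (· ≤ a) : Finset ℝ) : Set ℝ) := by
    ext x
    simp only [Set.mem_ofPred_eq, Set.mem_Ioc, Finset.coe_sdiff, Finset.coe_filter, Set.mem_sdiff,
      hR]
    grind
  have hsub : R.filter (· ≤ a) ⊆ R.filter (· ≤ b) :=
    Finset.monotone_filter_right _ fun x _ hx => le_trans hx hab.le
  rw [hset, Set.ncard_coe_finset, Finset.cast_card_sdiff hsub]
  omega
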